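/- Gradient of the training loss at equilibrium (equation (28)). Let g : ℝⁿ × ℝᵖ → ℝⁿ and x : ℝᵖ → ℝⁿ be differentiable maps with x(θ) = g(x(θ), θ) near θ⋆, let x̄ ∈ ℝⁿ be a fixed target, and define the loss l(θ) = (1/2)‖x(θ) − x̄‖². Write J := D₁g(x(θ⋆), θ⋆) and assume I − J is invertible. Then for every direction v ∈ ℝᵖ, the derivative of the loss satisfies Dl(θ⋆)(v) = ⟨(I − J)⁻ᵀ(x(θ⋆) − x̄), D₂g(x(θ⋆), θ⋆)(v)⟩; equivalently, the gradient is ∇l(θ⋆) = (D₂g)ᵀ (I − J)⁻ᵀ (x(θ⋆) − x̄). -/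

import Mathlib

open scoped RealInnerProductSpace

/-- Implicit differentiation of a fixed point: if `x θ = g (x θ, θ)` near `θs` and `1 - J` is
invertible, where `J` and `D₂` are the partial derivatives of `g`, then the derivative of `x` at
`θs` is `(1 - J)⁻¹ ∘ D₂`. -/
theorem HasFDerivAt.eq_inverse_comp_of_eventually_fixed {𝕜 E F : Type*}
    [NontriviallyNormedField 𝕜] [NormedAddCommGroup E] [NormedSpace 𝕜 E]
    [NormedAddCommGroup F] [NormedSpace 𝕜 F] {g : E × F → E} {x : F → E} {θs : F}
    {J : E →L[𝕜] E} {D₂ X : F →L[𝕜] E}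
    (hg : HasFDerivAt g (J.comp (ContinuousLinearMap.fst 𝕜 E F)
      + D₂.comp (ContinuousLinearMap.snd 𝕜 E F)) (x θs, θs))
    (hx : HasFDerivAt x X θs) (hfix : ∀ᶠ θ in nhds θs, x θ = g (x θ, θ))
    (hinv : IsUnit (1 - J)) :
    X = (Ring.inverse (1 - J)).comp D₂ := by
  have hgx := (HasFDerivAt.comp (f := fun θ => (x θ, θ)) θs hg
    (hx.prodMk (hasFDerivAt_id θs))).congr_of_eventuallyEq hfix
  ext v
  have hv : (1 - J) (X v) = D₂ v := by
    have h := DFunLike.congr_fun (hx.unique hgx) v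
    simpa [sub_eq_iff_eq_add'] using h
  have hcancel := DFunLike.congr_fun (Ring.inverse_mul_cancel _ hinv) (X v)
  rw [ContinuousLinearMap.comp_apply, ← hv]
  exact hcancel.symm

/-- **gradient of the training loss at equilibrium.**
Let `g : ℝⁿ × ℝᵖ → ℝⁿ` and `x : ℝᵖ → ℝⁿ` be differentiable maps with `x θ = g (x θ, θ)`
near `θ⋆`, let `xbar` be a fixed target, and `l θ = (1/2)‖x θ - xbar‖²`.  With
`J = D₁g (x θ⋆, θ⋆)` and `I - J` invertible, for every direction `v`,
`Dl(θ⋆)(v) = ⟪(I - J)⁻ᵀ (x θ⋆ - xbar), D₂g (x θ⋆, θ⋆) v⟫`; equivalently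
`∇l(θ⋆) = (D₂g)ᵀ (I - J)⁻ᵀ (x θ⋆ - xbar)`. -/
theorem deq_loss_gradient {n p : ℕ}
    (g : EuclideanSpace ℝ (Fin n) × EuclideanSpace ℝ (Fin p) → EuclideanSpace ℝ (Fin n))
    (x : EuclideanSpace ℝ (Fin p) → EuclideanSpace ℝ (Fin n))
    (θs : EuclideanSpace ℝ (Fin p)) (xbar : EuclideanSpace ℝ (Fin n))
    (J : EuclideanSpace ℝ (Fin n) →L[ℝ] EuclideanSpace ℝ (Fin n))
    (D₂ : EuclideanSpace ℝ (Fin p) →L[ℝ] EuclideanSpace ℝ (Fin n))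
    (X : EuclideanSpace ℝ (Fin p) →L[ℝ] EuclideanSpace ℝ (Fin n))
    (hg : HasFDerivAt g
      (J.comp (ContinuousLinearMap.fst ℝ (EuclideanSpace ℝ (Fin n)) (EuclideanSpace ℝ (Fin p)))
        + D₂.comp (ContinuousLinearMap.snd ℝ (EuclideanSpace ℝ (Fin n)) (EuclideanSpace ℝ (Fin p))))
      (x θs, θs))
    (hx : HasFDerivAt x X θs)
    (hfix : ∀ᶠ θ in nhds θs, x θ = g (x θ, θ))
    (hinv : IsUnit ((1 : EuclideanSpace ℝ (Fin n) →L[ℝ] EuclideanSpace ℝ (Fin n)) - J)) :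
    let l : EuclideanSpace ℝ (Fin p) → ℝ := fun θ => (1 / 2) * ‖x θ - xbar‖ ^ 2
    (∀ v : EuclideanSpace ℝ (Fin p),
        fderiv ℝ l θs v
          = ⟪ContinuousLinearMap.adjoint
              (Ring.inverse ((1 : EuclideanSpace ℝ (Fin n) →L[ℝ] EuclideanSpace ℝ (Fin n)) - J))
              (x θs - xbar), D₂ v⟫) ∧
      gradient l θs
        = ContinuousLinearMap.adjoint D₂
            (ContinuousLinearMap.adjoint
              (Ring.inverse ((1 : EuclideanSpace ℝ (Fin n) →L[ℝ] EuclideanSpace ℝ (Fin n)) - J))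
              (x θs - xbar)) := by
  intro l
  have hX := hg.eq_inverse_comp_of_eventually_fixed hx hfix hinv
  have hl : ∀ v, fderiv ℝ l θs v = ⟪x θs - xbar, X v⟫ := fun v => by
    have h : HasFDerivAt l _ θs := ((hx.sub_const xbar).norm_sq).const_mul (1 / 2)
    rw [h.fderiv]
    simp [inner_sub_left]
  have hdir : ∀ v, fderiv ℝ l θs v
      = ⟪ContinuousLinearMap.adjoint (Ring.inverse (1 - J)) (x θs - xbar), D₂ v⟫ := fun v => by
    rw [hl, hX, ContinuousLinearMap.adjoint_inner_left, ContinuousLinearMap.comp_apply]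
  refine ⟨hdir, ext_inner_right ℝ fun v => ?_⟩
  rw [gradient, InnerProductSpace.toDual_symm_apply, hdir,
    ContinuousLinearMap.adjoint_inner_left D₂]
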